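/- Let q be an odd prime power and n a positive integer. If A ⊆ F_q^n contains no right angle, i.e., there are no three distinct vectors x, y, z ∈ A with ⟨x−z, y−z⟩ = 0 (standard dot product), then |A| ≤ 4(q−1)q·C(n+q−2, q−2) + 2q. -/

import Mathlib

/-- A product of linear combinations of the functions `e j` is a linear combination of the
monomials in them. -/
theorem prod_sum_mem_span_monomials {ι J X F : Type*} [Fintype ι] [Fintype J] [Field F]
    (a : ι → J → F) (e : J → X → F) :
    (fun x => ∏ i, ∑ j, a i j * e j x) ∈ Submodule.span F
      (Set.range fun (s : Sym J (Fintype.card ι)) (x : X) => (s.1.map fun j => e j x).prod) := by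
  classical
  have h : (fun x => ∏ i, ∑ j, a i j * e j x) =
      ∑ p : ι → J, (∏ i, a i (p i)) • fun x => ∏ i, e (p i) x := by
    ext x
    simp [Finset.prod_univ_sum, Finset.sum_apply, Finset.prod_mul_distrib]
  rw [h]
  refine Submodule.sum_mem _ fun p _ => Submodule.smul_mem _ _ (Submodule.subset_span ?_)
  refine ⟨⟨Finset.univ.val.map p, by simp⟩, ?_⟩
  ext x
  simp [Multiset.map_map]

/-- A set of vectors of the same nonzero norm `c`, whose pairwise inner products avoid `0`
and `c`, is small. -/
theorem card_le_choose_of_dotProduct_ne {F : Type*} [Field F] [Fintype F] {n : ℕ}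
    (S : Finset (Fin n → F)) {c : F} (hc : c ≠ 0) (hdiag : ∀ x ∈ S, x ⬝ᵥ x = c)
    (hne : ∀ x ∈ S, ∀ y ∈ S, x ≠ y → x ⬝ᵥ y ≠ 0 ∧ x ⬝ᵥ y ≠ c) :
    S.card ≤ (n + Fintype.card F - 2).choose (Fintype.card F - 2) := by
  classical
  set V := {v : F // v ∈ ((Finset.univ.erase (0 : F)).erase c)}
  have hV : Fintype.card V = Fintype.card F - 2 := by
    rw [Fintype.card_coe, Finset.card_erase_of_mem (by simp [hc]),
      Finset.card_erase_of_mem (by simp), Finset.card_univ]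
    omega
  let e : Option (Fin n) → S → F := fun j y => j.elim 1 y.1
  let mono : Sym (Option (Fin n)) (Fintype.card V) → S → F :=
    fun s y => (s.1.map fun j => e j y).prod
  have hsingle (x : S) : Pi.single x 1 ∈ Submodule.span F (Set.range mono) := by
    have hmem := prod_sum_mem_span_monomials
      (fun (v : V) (j : Option (Fin n)) => j.elim (-v.1) x.1) e
    have hval (y : S) : (∏ v : V, ∑ j, (j.elim (-v.1) x.1 : F) * e j y) =
        ∏ v : V, (x.1 ⬝ᵥ y.1 - v.1) := by
      refine Finset.prod_congr rfl fun v _ => ?_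
      simp [e, Fintype.sum_option, dotProduct]
      ring
    have hx : ∏ v : V, (c - v.1) ≠ 0 := by
      refine Finset.prod_ne_zero_iff.2 fun v _ => sub_ne_zero.2 ?_
      exact (Finset.mem_erase.1 v.2).1.symm
    have heq : Pi.single x 1 = (∏ v : V, (c - v.1))⁻¹ •
        fun y : S => ∏ v : V, ∑ j, (j.elim (-v.1) x.1 : F) * e j y := by
      ext y
      rw [Pi.smul_apply, hval, smul_eq_mul]
      by_cases h_eq : y = x
      · subst h_eq
        rw [hdiag _ y.2, Pi.single_eq_same, inv_mul_cancel₀ hx]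
      · rw [Pi.single_eq_of_ne h_eq]
        obtain ⟨h0, h1⟩ := hne x x.2 y y.2 fun h => h_eq (Subtype.ext h.symm)
        have hzero : ∏ v : V, (x.1 ⬝ᵥ y.1 - v.1) = 0 :=
          Finset.prod_eq_zero (Finset.mem_univ ⟨x.1 ⬝ᵥ y.1, by simp [h0, h1]⟩) (sub_self _)
        rw [hzero, mul_zero]
    rw [heq]
    exact Submodule.smul_mem _ _ hmem
  have htop : Submodule.span F (Set.range mono) = ⊤ := by
    rw [eq_top_iff, ← (Pi.basisFun F S).span_eq, Submodule.span_le]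
    rintro _ ⟨x, rfl⟩
    simpa using hsingle x
  have hle := finrank_range_le_card (R := F) mono
  have hF : 1 < Fintype.card F := Fintype.one_lt_card
  rw [Set.finrank, htop, finrank_top, Module.finrank_fintype_fun_eq_card, Fintype.card_coe,
    Sym.card_sym_eq_choose, Fintype.card_option, Fintype.card_fin, hV] at hle
  convert hle using 2
  omega

/-- No three distinct points of `A` form a right angle. -/
def RightAngleFree {F : Type*} [Field F] {n : ℕ} (A : Finset (Fin n → F)) : Prop :=
  ∀ x ∈ A, ∀ y ∈ A, ∀ z ∈ A, x ≠ y → y ≠ z → x ≠ z → (x - z) ⬝ᵥ (y - z) ≠ 0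

theorem RightAngleFree.mono {F : Type*} [Field F] {n : ℕ} {A B : Finset (Fin n → F)}
    (hA : RightAngleFree A) (h : B ⊆ A) : RightAngleFree B :=
  fun x hx y hy z hz => hA x (h hx) y (h hy) z (h hz)

/-- A sphere of nonzero radius about a point of a right-angle-free set contains few of its
points. -/
theorem RightAngleFree.card_sphere_le {F : Type*} [Field F] [Fintype F] [DecidableEq F] {n : ℕ}
    {A : Finset (Fin n → F)} (hA : RightAngleFree A) {z : Fin n → F} (hz : z ∈ A)
    {c : F} (hc : c ≠ 0) :
    (A.filter fun x => (x - z) ⬝ᵥ (x - z) = c).card ≤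
      (n + Fintype.card F - 2).choose (Fintype.card F - 2) := by
  rw [← Finset.card_image_of_injective _ (sub_left_injective (b := z))]
  have hxz {x : Fin n → F} (hx : (x - z) ⬝ᵥ (x - z) = c) : x ≠ z := by
    rintro rfl
    exact hc (by simpa using hx.symm)
  refine card_le_choose_of_dotProduct_ne _ hc ?_ ?_
  · simp only [Finset.mem_image, Finset.mem_filter]
    rintro _ ⟨x, ⟨-, hxc⟩, rfl⟩
    exact hxc
  · simp only [Finset.mem_image, Finset.mem_filter]
    rintro _ ⟨x, ⟨hx, hxc⟩, rfl⟩ _ ⟨y, ⟨hy, hyc⟩, rfl⟩ hne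
    have hxy : x ≠ y := fun h => hne (by rw [h])
    refine ⟨hA x hx y hy z hz hxy (hxz hyc) (hxz hxc), fun h => ?_⟩
    refine hA y hy z hz x hx (hxz hyc) (hxz hxc).symm hxy.symm ?_
    rw [← sub_sub_sub_cancel_right y x z, ← neg_sub x z, dotProduct_neg, sub_dotProduct,
      dotProduct_comm, h, hxc, sub_self, neg_zero]

/-- A right-angle-free set contains few points at nonzero distance from a given one of its
points. -/
theorem RightAngleFree.card_filter_ne_zero_le {F : Type*} [Field F] [Fintype F] [DecidableEq F]
    {n : ℕ} {A : Finset (Fin n → F)} (hA : RightAngleFree A) {z : Fin n → F} (hz : z ∈ A) :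
    (A.filter fun x => (x - z) ⬝ᵥ (x - z) ≠ 0).card ≤ (Fintype.card F - 1) *
      (n + Fintype.card F - 2).choose (Fintype.card F - 2) := by
  have hsub : (A.filter fun x => (x - z) ⬝ᵥ (x - z) ≠ 0) ⊆
      (Finset.univ.erase (0 : F)).biUnion
        fun c => A.filter fun x => (x - z) ⬝ᵥ (x - z) = c := by
    intro x hx
    simpa [and_comm] using hx
  refine (Finset.card_le_card hsub).trans ?_
  rw [← Finset.card_univ, ← Finset.card_erase_of_mem (Finset.mem_univ (0 : F)), Finset.card_univ]
  exact Finset.card_biUnion_le_card_mul _ _ _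
    fun c hc => hA.card_sphere_le hz (Finset.ne_of_mem_erase hc)

/-- A right-angle-free set contains few points at distance zero from a given one of its
points. -/
theorem RightAngleFree.card_filter_eq_zero_le {F : Type*} [Field F] [Fintype F] [DecidableEq F]
    (hF : (2 : F) ≠ 0) {n : ℕ} {A : Finset (Fin n → F)} (hA : RightAngleFree A)
    {z : Fin n → F} (hz : z ∈ A) :
    (A.filter fun x => (x - z) ⬝ᵥ (x - z) = 0).card ≤ (Fintype.card F - 1) *
      (n + Fintype.card F - 2).choose (Fintype.card F - 2) + 2 := by
  set B := A.filter fun x => (x - z) ⬝ᵥ (x - z) = 0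
  by_cases hw : ∃ w ∈ B, w ≠ z
  · obtain ⟨w, hwB, hwz⟩ := hw
    have hcover : B ⊆ (B.filter fun x => (x - w) ⬝ᵥ (x - w) ≠ 0) ∪ {w, z} := by
      intro x hx
      by_cases hxw : x = w
      · simp [hxw]
      by_cases hxz : x = z
      · simp [hxz]
      refine Finset.mem_union_left _ (Finset.mem_filter.2 ⟨hx, fun h => ?_⟩)
      obtain ⟨hxA, hx0⟩ := Finset.mem_filter.1 hx
      obtain ⟨hwA, hw0⟩ := Finset.mem_filter.1 hwB
      refine hA x hxA w hwA z hz hxw hwz hxz ?_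
      rw [← sub_sub_sub_cancel_right x w z, sub_dotProduct, dotProduct_sub (x - z) (x - z),
        dotProduct_sub (w - z) (x - z), hx0, hw0, dotProduct_comm (w - z)] at h
      refine (mul_eq_zero.1 (?_ : (2 : F) * _ = 0)).resolve_left hF
      linear_combination -h
    refine (Finset.card_le_card hcover).trans ((Finset.card_union_le _ _).trans ?_)
    exact add_le_add ((hA.mono (Finset.filter_subset _ _)).card_filter_ne_zero_le hwB)
      Finset.card_le_two
  · push Not at hw
    have : B ⊆ {z} := fun x hx => Finset.mem_singleton.2 (hw x hx)
    have := Finset.card_le_card this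
    rw [Finset.card_singleton] at this
    omega

/-- no right angle in `A ⊆ F_q^n` implies
`|A| ≤ 4(q-1)q·C(n+q-2, q-2) + 2q`, for `q` an odd prime power. -/
theorem rightAngleFree_card_bound (q n : ℕ) (F : Type*) [Field F] [Fintype F]
    (hq : Fintype.card F = q) (hodd : Odd q) (hn : 0 < n)
    (A : Finset (Fin n → F))
    (hA : ∀ x ∈ A, ∀ y ∈ A, ∀ z ∈ A, x ≠ y → y ≠ z → x ≠ z →
      ∑ i, (x i - z i) * (y i - z i) ≠ 0) :
    A.card ≤ 4 * (q - 1) * q * Nat.choose (n + q - 2) (q - 2) + 2 * q := by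
  classical
  subst hq
  have hF : (2 : F) ≠ 0 := Ring.two_ne_zero fun h =>
    Nat.not_even_iff_odd.2 hodd (FiniteField.even_card_iff_char_two.1 h |> Nat.even_iff.2)
  have hA' : RightAngleFree A := hA
  obtain rfl | ⟨z, hz⟩ := A.eq_empty_or_nonempty
  · simp
  have h0 := hA'.card_filter_eq_zero_le hF hz
  have h1 := hA'.card_filter_ne_zero_le hz
  have hsum := Finset.card_filter_add_card_filter_not (s := A)
    (fun x => (x - z) ⬝ᵥ (x - z) = 0)
  have hpos : 1 ≤ Fintype.card F := Fintype.card_pos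
  set C := (n + Fintype.card F - 2).choose (Fintype.card F - 2)
  have hmul : (Fintype.card F - 1) * C ≤ (Fintype.card F - 1) * Fintype.card F * C :=
    Nat.mul_le_mul_right _ (Nat.le_mul_of_pos_right _ hpos)
  have hassoc : 4 * (Fintype.card F - 1) * Fintype.card F * C =
      4 * ((Fintype.card F - 1) * Fintype.card F * C) := by ring
  simp only [ne_eq] at h1
  omega
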